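/- arXiv:2410.05493 — 2 statements merged into one kernel-verified Lean document; each statement's English description precedes it below -/
import Mathlib

section
/- Let ω_{n,l} be the CTW mixture weights and p̄_{n,s} the per-suffix Bayesian predictor. Then the Bayesian optimal next-token probability, given by the ratio of root CTW weighted probabilities, satisfies p^w_{n+1,()} / p^w_{n,()} = Σ_{l=0}^{D} ω_{n,l} · p̄_{n,s_{n,l}}(x_{n+1}), where p^w_{n+1,·} is computed from the counting vectors 𝐧_{n+1,·} of the sequence extended by one more symbol x_{n+1} ∈ 𝒜. -/
open scoped Classical

noncomputable section

variable {𝒜 : Type*}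

/-- The finset of all strings over `𝒜` of length at most `D`. -/
def stringsLe (𝒜 : Type*) [Fintype 𝒜] (D : ℕ) : Finset (List 𝒜) :=
  Set.Finite.toFinset (List.finite_length_le 𝒜 D)

/-- A context tree of maximum depth `D`, identified with its leaf set: every leaf has length
at most `D`, no leaf is a (proper) suffix of another, and every string of length `D` has
exactly one suffix among the leaves. -/
def IsContextTree (D : ℕ) (T : Finset (List 𝒜)) : Prop :=
  (∀ s ∈ T, s.length ≤ D) ∧
  (∀ s ∈ T, ∀ t ∈ T, s <:+ t → s = t) ∧
  (∀ w : List 𝒜, w.length = D → ∃! s, s ∈ T ∧ s <:+ w)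

/-- The finset of all context trees of maximum depth `D`. -/
def contextTrees (𝒜 : Type*) [Fintype 𝒜] (D : ℕ) : Finset (Finset (List 𝒜)) :=
  (stringsLe 𝒜 D).powerset.filter (IsContextTree D)

/-- The branching-process prior `π_D` on context trees. -/
def priorD [Fintype 𝒜] (lam : ℝ) (D : ℕ) (T : Finset (List 𝒜)) : ℝ :=
  (1 - lam) ^ ((T.card - 1) / (Fintype.card 𝒜 - 1)) *
    lam ^ (T.card - (T.filter (fun s => s.length = D)).card)

/-- The window `(x_{1-D}, …, x_{j-1})`. -/
def window (x : ℤ → 𝒜) (D : ℕ) (j : ℕ) : List 𝒜 :=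
  (List.range (D + j - 1)).map (fun i => x (1 - (D : ℤ) + (i : ℤ)))

/-- The counting vector `𝐧_{n,s}(a)`. -/
def cnt [DecidableEq 𝒜] (x : ℤ → 𝒜) (D n : ℕ) (s : List 𝒜) (a : 𝒜) : ℕ :=
  ((Finset.Icc 1 n).filter (fun (j : ℕ) => x (j : ℤ) = a ∧ s <:+ window x D j)).card

/-- The evidence value `P^e(m)` of a counting vector `m` under Dirichlet parameters `α`. -/
def pEv [Fintype 𝒜] (α : 𝒜 → ℝ) (m : 𝒜 → ℕ) : ℝ :=
  (Real.Gamma (∑ a, α a) / Real.Gamma (∑ a, ((m a : ℝ) + α a))) *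
    ∏ a, (Real.Gamma ((m a : ℝ) + α a) / Real.Gamma (α a))

/-- The evidence `p^e_{n,s}`. -/
def pE [Fintype 𝒜] [DecidableEq 𝒜] (α : 𝒜 → ℝ) (x : ℤ → 𝒜) (D n : ℕ) (s : List 𝒜) : ℝ :=
  pEv α (cnt x D n s)

/-- Auxiliary downward recursion for the CTW weighted probabilities, with fuel `k = D - |s|`. -/
def pWaux [Fintype 𝒜] [DecidableEq 𝒜] (α : 𝒜 → ℝ) (lam : ℝ) (x : ℤ → 𝒜) (D n : ℕ) :
    ℕ → List 𝒜 → ℝ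
  | 0, s => pE α x D n s
  | k + 1, s => lam * pE α x D n s + (1 - lam) * ∏ q, pWaux α lam x D n k (q :: s)

/-- The CTW weighted probability `p^w_{n,s}`. -/
def pW [Fintype 𝒜] [DecidableEq 𝒜] (α : 𝒜 → ℝ) (lam : ℝ) (x : ℤ → 𝒜) (D n : ℕ)
    (s : List 𝒜) : ℝ :=
  pWaux α lam x D n (D - s.length) s

/-- The observed suffix `s_{n,l} = (x_{n-l+1}, …, x_n)` of length `l`. -/
def sfx (x : ℤ → 𝒜) (n : ℤ) (l : ℕ) : List 𝒜 :=
  (List.range l).map (fun i => x (n - (l : ℤ) + 1 + (i : ℤ)))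

/-- The CTW mixture weight `ω_{n,l}`. -/
def omegaW [Fintype 𝒜] [DecidableEq 𝒜] (α : 𝒜 → ℝ) (lam : ℝ) (x : ℤ → 𝒜) (D n l : ℕ) : ℝ :=
  (∑ T ∈ (contextTrees 𝒜 D).filter (fun T => sfx x n l ∈ T),
      priorD lam D T * ∏ s ∈ T, pE α x D n s) / pW α lam x D n []

/-- The per-suffix Bayesian predictor `p̄_{n,s}(a)`. -/
def pBar [Fintype 𝒜] [DecidableEq 𝒜] (α : 𝒜 → ℝ) (x : ℤ → 𝒜) (D n : ℕ) (s : List 𝒜)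
    (a : 𝒜) : ℝ :=
  (α a + cnt x D n s a) / ∑ q, (α q + cnt x D n s q)

end

namespace ContextTree

variable {𝒜 : Type*}

theorem concat_suffix_concat_iff {s t : List 𝒜} {p q : 𝒜} :
    s ++ [p] <:+ t ++ [q] ↔ p = q ∧ s <:+ t := by
  rw [List.suffix_append_inj_of_length_eq (by simp)]
  simp [and_comm]

/-- The subtree of `T` at the child `q` of the root. -/
noncomputable def branch (T : Finset (List 𝒜)) (q : 𝒜) : Finset (List 𝒜) :=
  T.preimage (fun t => t ++ [q]) (List.append_left_injective [q]).injOn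

/-- The tree whose subtree at the child `q` of the root is `F q`. -/
noncomputable def join [Fintype 𝒜] (F : 𝒜 → Finset (List 𝒜)) : Finset (List 𝒜) :=
  Finset.univ.biUnion fun q => (F q).image fun t => t ++ [q]

theorem mem_branch {T : Finset (List 𝒜)} {q : 𝒜} {t : List 𝒜} :
    t ∈ branch T q ↔ t ++ [q] ∈ T := by
  simp [branch]

theorem concat_mem_join [Fintype 𝒜] {F : 𝒜 → Finset (List 𝒜)} {q : 𝒜} {t : List 𝒜} :
    t ++ [q] ∈ join F ↔ t ∈ F q := by
  simp only [join, Finset.mem_biUnion, Finset.mem_univ, true_and, Finset.mem_image]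
  constructor
  · rintro ⟨p, s, hs, h⟩
    obtain ⟨rfl, h⟩ := List.append_inj' h rfl
    obtain rfl : p = q := by simpa using h
    exact hs
  · exact fun h => ⟨q, t, h, rfl⟩

theorem nil_notMem_join [Fintype 𝒜] (F : 𝒜 → Finset (List 𝒜)) : [] ∉ join F := by
  simp [join]

theorem branch_join [Fintype 𝒜] (F : 𝒜 → Finset (List 𝒜)) : branch (join F) = F := by
  ext q t
  rw [mem_branch, concat_mem_join]

theorem join_branch [Fintype 𝒜] {T : Finset (List 𝒜)} (hT : [] ∉ T) : join (branch T) = T := by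
  ext t
  rcases List.eq_nil_or_concat' t with rfl | ⟨t, q, rfl⟩
  · simp [nil_notMem_join, hT]
  · rw [concat_mem_join, mem_branch]

@[to_additive]
theorem prod_eq_prod_branch [Fintype 𝒜] {M : Type*} [CommMonoid M] {T : Finset (List 𝒜)}
    (hT : [] ∉ T) (f : List 𝒜 → M) :
    ∏ t ∈ T, f t = ∏ q, ∏ t ∈ branch T q, f (t ++ [q]) := by
  rw [Finset.prod_sigma']
  symm
  refine Finset.prod_bij (fun z _ => z.2 ++ [z.1]) ?_ ?_ ?_ fun _ _ => rfl
  · rintro ⟨q, t⟩ h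
    simpa [mem_branch] using h
  · rintro ⟨p, s⟩ - ⟨q, t⟩ - h
    obtain ⟨rfl, h⟩ := List.append_inj' h rfl
    obtain rfl : p = q := by simpa using h
    rfl
  · intro t ht
    rcases List.eq_nil_or_concat' t with rfl | ⟨t, q, rfl⟩
    · exact absurd ht hT
    · exact ⟨⟨q, t⟩, by simpa [mem_branch] using ht, rfl⟩

theorem eq_singleton_nil_of_nil_mem {D : ℕ} {T : Finset (List 𝒜)} (hT : IsContextTree D T)
    (h : [] ∈ T) : T = {[]} := by
  ext t
  rw [Finset.mem_singleton]
  exact ⟨fun ht => (hT.2.1 [] h t ht List.nil_suffix).symm, fun ht => ht ▸ h⟩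

theorem isContextTree_singleton_nil (D : ℕ) : IsContextTree D ({[]} : Finset (List 𝒜)) := by
  refine ⟨by simp, by simp, fun w _ => ⟨[], by simp, fun s hs => by simpa using hs.1⟩⟩

theorem isContextTree_zero_iff {T : Finset (List 𝒜)} : IsContextTree 0 T ↔ T = {[]} := by
  refine ⟨fun hT => ?_, fun h => h ▸ isContextTree_singleton_nil 0⟩
  obtain ⟨s, ⟨hs, hsw⟩, -⟩ := hT.2.2 [] rfl
  obtain rfl : s = [] := List.suffix_nil.mp hsw
  exact eq_singleton_nil_of_nil_mem hT hs

theorem isContextTree_succ_iff {D : ℕ} {T : Finset (List 𝒜)} (hT : [] ∉ T) :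
    IsContextTree (D + 1) T ↔ ∀ q, IsContextTree D (branch T q) := by
  constructor
  · rintro ⟨hlen, hsuff, hex⟩ q
    refine ⟨fun s hs => ?_, fun s hs t ht hst => ?_, fun w hw => ?_⟩
    · simpa using hlen _ (mem_branch.mp hs)
    · exact List.append_left_injective [q]
        (hsuff _ (mem_branch.mp hs) _ (mem_branch.mp ht) (concat_suffix_concat_iff.mpr ⟨rfl, hst⟩))
    · obtain ⟨s, ⟨hs, hsw⟩, huniq⟩ := hex (w ++ [q]) (by simpa using hw)
      rcases List.eq_nil_or_concat' s with rfl | ⟨s, p, rfl⟩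
      · exact absurd hs hT
      obtain ⟨rfl, hsuffix⟩ := concat_suffix_concat_iff.mp hsw
      refine ⟨s, ⟨mem_branch.mpr hs, hsuffix⟩, fun t ht => List.append_left_injective [p] ?_⟩
      exact huniq _ ⟨mem_branch.mp ht.1, concat_suffix_concat_iff.mpr ⟨rfl, ht.2⟩⟩
  · intro h
    refine ⟨fun s hs => ?_, fun s hs t ht hst => ?_, fun w hw => ?_⟩
    · rcases List.eq_nil_or_concat' s with rfl | ⟨s, p, rfl⟩
      · simp
      · simpa using (h p).1 s (mem_branch.mpr hs)
    · rcases List.eq_nil_or_concat' s with rfl | ⟨s, p, rfl⟩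
      · exact absurd hs hT
      rcases List.eq_nil_or_concat' t with rfl | ⟨t, q, rfl⟩
      · exact absurd ht hT
      obtain ⟨rfl, hsuffix⟩ := concat_suffix_concat_iff.mp hst
      rw [(h p).2.1 s (mem_branch.mpr hs) t (mem_branch.mpr ht) hsuffix]
    · rcases List.eq_nil_or_concat' w with rfl | ⟨w, q, rfl⟩
      · simp at hw
      obtain ⟨s, ⟨hs, hsw⟩, huniq⟩ := (h q).2.2 w (by simpa using hw)
      refine ⟨s ++ [q], ⟨mem_branch.mp hs, concat_suffix_concat_iff.mpr ⟨rfl, hsw⟩⟩, ?_⟩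
      rintro t ⟨ht, htw⟩
      rcases List.eq_nil_or_concat' t with rfl | ⟨t, p, rfl⟩
      · exact absurd ht hT
      obtain ⟨rfl, hsuffix⟩ := concat_suffix_concat_iff.mp htw
      rw [huniq t ⟨mem_branch.mpr ht, hsuffix⟩]

theorem sfx_eq_map (x : ℤ → 𝒜) (n : ℤ) (l : ℕ) :
    sfx x n l = (List.range l).map fun i : ℕ => x (n - l + 1 + i) := by
  simp [sfx, Function.comp_def, ← List.map_eq_flatMap]

theorem window_eq_map (x : ℤ → 𝒜) (D j : ℕ) :
    window x D j = (List.range (D + j - 1)).map fun i : ℕ => x (1 - D + i) := by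
  simp [window, Function.comp_def, ← List.map_eq_flatMap]

theorem length_sfx (x : ℤ → 𝒜) (n : ℤ) (l : ℕ) : (sfx x n l).length = l := by
  simp [sfx_eq_map]

theorem sfx_suffix_window (x : ℤ → 𝒜) {D n l : ℕ} (h : l ≤ D) :
    sfx x n l <:+ window x D (n + 1) := by
  rw [List.suffix_iff_eq_drop]
  refine List.ext_getElem ?_ fun i hi _ => ?_
  · simp [sfx_eq_map, window_eq_map]
    omega
  · simp only [sfx_eq_map, window_eq_map, List.getElem_map, List.getElem_range, List.getElem_drop,
      List.length_map, List.length_range]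
    congr 1
    omega

theorem suffix_window_iff (x : ℤ → 𝒜) {D n : ℕ} {s : List 𝒜} (h : s.length ≤ D) :
    s <:+ window x D (n + 1) ↔ s = sfx x n s.length := by
  refine ⟨fun hs => ?_, fun hs => hs ▸ sfx_suffix_window x h⟩
  refine (List.suffix_of_suffix_length_le hs (sfx_suffix_window x h) ?_).eq_of_length ?_ <;>
    simp [length_sfx]

theorem cnt_succ [DecidableEq 𝒜] (x : ℤ → 𝒜) (D n : ℕ) (s : List 𝒜) (a : 𝒜) :
    cnt x D (n + 1) s a =
      cnt x D n s a + if s <:+ window x D (n + 1) ∧ x (n + 1) = a then 1 else 0 := by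
  rw [cnt, cnt, Finset.card_filter, Finset.card_filter, Finset.sum_Icc_succ_top (by omega)]
  simp [and_comm]

/-- In a context tree exactly one leaf is an observed suffix. -/
theorem prod_suffix_eq_sum_sfx [DecidableEq 𝒜] {D : ℕ} {T : Finset (List 𝒜)} (hT : IsContextTree D T)
    (x : ℤ → 𝒜) (n : ℕ) (f : List 𝒜 → ℝ) :
    (∏ s ∈ T, if s <:+ window x D (n + 1) then f s else 1) =
      ∑ l ∈ Finset.range (D + 1), if sfx x n l ∈ T then f (sfx x n l) else 0 := by
  obtain ⟨s, ⟨hs, hsw⟩, huniq⟩ := hT.2.2 (sfx x n D) (length_sfx x n D)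
  have hmem : ∀ t ∈ T, t <:+ window x D (n + 1) → t = s := fun t ht htw =>
    huniq t ⟨ht, List.suffix_of_suffix_length_le htw (sfx_suffix_window x le_rfl)
      (by rw [length_sfx]; exact hT.1 t ht)⟩
  have hsw' : s <:+ window x D (n + 1) := hsw.trans (sfx_suffix_window x le_rfl)
  have hlen := hT.1 s hs
  have hsfx := (suffix_window_iff x hlen).mp hsw'
  rw [Finset.prod_eq_single_of_mem s hs fun t ht hts => if_neg fun h => hts (hmem t ht h),
    if_pos hsw', Finset.sum_eq_single_of_mem s.length (Finset.mem_range.mpr (by omega)),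
    ← hsfx, if_pos hs]
  intro l hl hne
  refine if_neg fun h => hne ?_
  rw [← hmem _ h (sfx_suffix_window x (by simpa [Nat.lt_succ_iff] using hl)), length_sfx]

variable [Fintype 𝒜]

theorem mem_contextTrees {D : ℕ} {T : Finset (List 𝒜)} :
    T ∈ contextTrees 𝒜 D ↔ IsContextTree D T := by
  simp only [contextTrees, Finset.mem_filter, Finset.mem_powerset, and_iff_right_iff_imp]
  exact fun hT s hs => by simpa [stringsLe] using hT.1 s hs

theorem card_eq_sum_branch {T : Finset (List 𝒜)} (hT : [] ∉ T) :
    T.card = ∑ q, (branch T q).card := by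
  simp only [Finset.card_eq_sum_ones]
  exact sum_eq_sum_branch hT fun _ => 1

theorem card_eq_of_card_branch (hA : 0 < Fintype.card 𝒜) {T : Finset (List 𝒜)} (h : [] ∉ T)
    {m : 𝒜 → ℕ} (hm : ∀ q, (branch T q).card = m q * (Fintype.card 𝒜 - 1) + 1) :
    T.card = (∑ q, m q + 1) * (Fintype.card 𝒜 - 1) + 1 := by
  rw [card_eq_sum_branch h, Finset.sum_congr rfl fun q _ => hm q, Finset.sum_add_distrib,
    ← Finset.sum_mul, add_mul]
  simp only [Finset.sum_const, Finset.card_univ, smul_eq_mul]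
  omega

/-- The number of leaves of a context tree is one more than a multiple of `A - 1`. -/
theorem exists_card_eq {D : ℕ} {T : Finset (List 𝒜)} (hA : 0 < Fintype.card 𝒜)
    (hT : IsContextTree D T) : ∃ m, T.card = m * (Fintype.card 𝒜 - 1) + 1 := by
  induction D generalizing T with
  | zero => exact ⟨0, by simp [isContextTree_zero_iff.mp hT]⟩
  | succ D ih =>
    by_cases h : [] ∈ T
    · exact ⟨0, by simp [eq_singleton_nil_of_nil_mem hT h]⟩
    choose m hm using fun q => ih ((isContextTree_succ_iff h).mp hT q)
    exact ⟨∑ q, m q + 1, card_eq_of_card_branch hA h hm⟩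

theorem priorD_eq (lam : ℝ) (D : ℕ) (T : Finset (List 𝒜)) :
    priorD lam D T = (1 - lam) ^ ((T.card - 1) / (Fintype.card 𝒜 - 1)) *
      ∏ t ∈ T, if t.length = D then 1 else lam := by
  rw [priorD, Finset.prod_ite, Finset.prod_const_one, one_mul, Finset.prod_const,
    ← Finset.card_filter_add_card_filter_not (s := T) fun t => t.length = D, Nat.add_sub_cancel_left]

theorem priorD_succ (hA : 2 ≤ Fintype.card 𝒜) (lam : ℝ) {D : ℕ} {T : Finset (List 𝒜)}
    (h : [] ∉ T) (hT : IsContextTree (D + 1) T) :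
    priorD lam (D + 1) T = (1 - lam) * ∏ q, priorD lam D (branch T q) := by
  have hpos : 0 < Fintype.card 𝒜 - 1 := by omega
  choose m hm using fun q => exists_card_eq (by omega) ((isContextTree_succ_iff h).mp hT q)
  have hcard := card_eq_of_card_branch (by omega) h hm
  simp only [priorD_eq, hcard, hm, Nat.add_sub_cancel, Nat.mul_div_cancel _ hpos,
    prod_eq_prod_branch h, Finset.prod_mul_distrib, Finset.prod_pow_eq_pow_sum, pow_succ,
    List.length_append, List.length_singleton, Nat.add_right_cancel_iff]
  ring

theorem sum_contextTrees_zero (f : Finset (List 𝒜) → ℝ) :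
    ∑ T ∈ contextTrees 𝒜 0, f T = f {[]} := by
  rw [show contextTrees 𝒜 0 = {{[]}} by ext T; simp [mem_contextTrees, isContextTree_zero_iff],
    Finset.sum_singleton]

theorem sum_contextTrees_succ [DecidableEq 𝒜] (D : ℕ) (f : Finset (List 𝒜) → ℝ) :
    ∑ T ∈ contextTrees 𝒜 (D + 1), f T =
      f {[]} + ∑ F ∈ Fintype.piFinset fun _ : 𝒜 => contextTrees 𝒜 D, f (join F) := by
  rw [← Finset.sum_filter_add_sum_filter_not _ fun T => [] ∈ T]
  congr 1
  · rw [show (contextTrees 𝒜 (D + 1)).filter (fun T => [] ∈ T) = {{[]}} from ?_,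
      Finset.sum_singleton]
    ext T
    simp only [Finset.mem_filter, mem_contextTrees, Finset.mem_singleton]
    refine ⟨fun h => eq_singleton_nil_of_nil_mem h.1 h.2, ?_⟩
    rintro rfl
    exact ⟨isContextTree_singleton_nil _, by simp⟩
  · refine Finset.sum_bij' (fun T _ => branch T) (fun F _ => join F) ?_ ?_ ?_ ?_ ?_
    · intro T hT
      simp only [Finset.mem_filter, mem_contextTrees] at hT
      simpa [mem_contextTrees] using (isContextTree_succ_iff hT.2).mp hT.1
    · intro F hF
      simp only [Fintype.mem_piFinset, mem_contextTrees] at hF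
      simp only [Finset.mem_filter, mem_contextTrees]
      refine ⟨(isContextTree_succ_iff (nil_notMem_join F)).mpr ?_, nil_notMem_join F⟩
      rwa [branch_join]
    · exact fun T hT => join_branch (Finset.mem_filter.mp hT).2
    · exact fun F _ => branch_join F
    · exact fun T hT => by rw [join_branch (Finset.mem_filter.mp hT).2]

variable [DecidableEq 𝒜]

/-- The weighted probabilities are prior averages of products of evidences over trees. -/
theorem pWaux_eq_sum (hA : 2 ≤ Fintype.card 𝒜) (α : 𝒜 → ℝ) (lam : ℝ) (x : ℤ → 𝒜) (D n k : ℕ)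
    (s : List 𝒜) :
    pWaux α lam x D n k s =
      ∑ T ∈ contextTrees 𝒜 k, priorD lam k T * ∏ t ∈ T, pE α x D n (t ++ s) := by
  induction k generalizing s with
  | zero => simp [sum_contextTrees_zero, pWaux, priorD_eq]
  | succ k ih =>
    rw [pWaux, sum_contextTrees_succ]
    congr 1
    · simp [priorD_eq]
    · rw [Finset.prod_congr rfl fun q _ => ih (q :: s), Finset.prod_univ_sum, Finset.mul_sum]
      refine Finset.sum_congr rfl fun F hF => ?_
      have hF' : IsContextTree (k + 1) (join F) := by
        rw [isContextTree_succ_iff (nil_notMem_join F), branch_join]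
        exact fun q => mem_contextTrees.mp (Fintype.mem_piFinset.mp hF q)
      rw [priorD_succ hA lam (nil_notMem_join F) hF', prod_eq_prod_branch (nil_notMem_join F),
        branch_join, Finset.prod_mul_distrib, mul_assoc]
      simp

theorem pW_nil_eq_sum (hA : 2 ≤ Fintype.card 𝒜) (α : 𝒜 → ℝ) (lam : ℝ) (x : ℤ → 𝒜) (D n : ℕ) :
    pW α lam x D n [] =
      ∑ T ∈ contextTrees 𝒜 D, priorD lam D T * ∏ t ∈ T, pE α x D n t := by
  simp [pW, pWaux_eq_sum hA]

/-- Incrementing the count of `a` multiplies the Dirichlet evidence by the predictive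
probability of `a`. -/
theorem pEv_update {α : 𝒜 → ℝ} (hα : ∀ a, 0 < α a) (m : 𝒜 → ℕ) (a : 𝒜) :
    pEv α (fun b => m b + if a = b then 1 else 0) =
      pEv α m * ((α a + m a) / ∑ q, (α q + m q)) := by
  have hpos : ∀ q, 0 < (m q : ℝ) + α q := fun q => by have := hα q; positivity
  have hS : 0 < ∑ q, ((m q : ℝ) + α q) := Finset.sum_pos (fun q _ => hpos q) ⟨a, by simp⟩
  have hsum : ∑ q, (((m q + if a = q then 1 else 0 : ℕ) : ℝ) + α q) =
      ∑ q, ((m q : ℝ) + α q) + 1 := by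
    simp only [Nat.cast_add, Finset.sum_add_distrib]
    simp
    ring
  have hprod : ∏ q, (Real.Gamma (((m q + if a = q then 1 else 0 : ℕ) : ℝ) + α q) /
        Real.Gamma (α q)) =
      (m a + α a) * ∏ q, (Real.Gamma ((m q : ℝ) + α q) / Real.Gamma (α q)) := by
    rw [← Finset.mul_prod_erase _ _ (Finset.mem_univ a),
      ← Finset.mul_prod_erase _ (fun q => Real.Gamma ((m q : ℝ) + α q) / Real.Gamma (α q))
        (Finset.mem_univ a)]
    rw [← mul_assoc]
    congr 1
    · rw [if_pos rfl, Nat.cast_add, Nat.cast_one, add_right_comm, Real.Gamma_add_one (hpos a).ne',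
        mul_div_assoc]
    · refine Finset.prod_congr rfl fun q hq => ?_
      rw [if_neg (Finset.ne_of_mem_erase hq).symm, add_zero]
  have hcomm : ∑ q, (α q + m q) = ∑ q, ((m q : ℝ) + α q) :=
    Finset.sum_congr rfl fun q _ => add_comm _ _
  rw [pEv, hsum, hprod, pEv, hcomm, Real.Gamma_add_one hS.ne']
  have := (Real.Gamma_pos_of_pos hS).ne'
  field_simp
  ring

theorem pE_succ {α : 𝒜 → ℝ} (hα : ∀ a, 0 < α a) (x : ℤ → 𝒜) (D n : ℕ) (s : List 𝒜) :
    pE α x D (n + 1) s = pE α x D n s *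
      if s <:+ window x D (n + 1) then pBar α x D n s (x (n + 1)) else 1 := by
  rw [pE, funext (cnt_succ x D n s)]
  by_cases h : s <:+ window x D (n + 1)
  · simp only [h, true_and, if_true]
    exact pEv_update hα _ _
  · simp [h, pE]

end ContextTree

/-- The Bayesian optimal next-token probability, given as the ratio of root CTW
weighted probabilities (the numerator computed from the counting vectors of the sequence extended
by the symbol `x (n+1)`), equals the mixture `Σ_l ω_{n,l} p̄_{n,s_{n,l}}(x_{n+1})`. -/
theorem ctw_next_token_representation {𝒜 : Type*} [Fintype 𝒜] [DecidableEq 𝒜]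
    (hA : 2 ≤ Fintype.card 𝒜) (D n : ℕ) (hD : 1 ≤ D) (hn : 1 ≤ n)
    (lam : ℝ) (hlam : lam ∈ Set.Ioo (0 : ℝ) 1)
    (α : 𝒜 → ℝ) (hα : ∀ a, 0 < α a) (x : ℤ → 𝒜) :
    pW α lam x D (n + 1) [] / pW α lam x D n [] =
      ∑ l ∈ Finset.range (D + 1),
        omegaW α lam x D n l * pBar α x D n (sfx x (n : ℤ) l) (x ((n : ℤ) + 1)) := by
  rw [ContextTree.pW_nil_eq_sum hA α lam x D (n + 1)]
  simp only [omegaW, div_mul_eq_mul_div]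
  rw [← Finset.sum_div]
  congr 1
  simp only [Finset.sum_mul, Finset.sum_filter]
  rw [Finset.sum_comm]
  refine Finset.sum_congr rfl fun T hT => ?_
  rw [Finset.prod_congr rfl fun s _ => ContextTree.pE_succ hα x D n s, Finset.prod_mul_distrib,
    ContextTree.prod_suffix_eq_sum_sfx (ContextTree.mem_contextTrees.mp hT) x n
      fun s => pBar α x D n s (x (n + 1)), ← mul_assoc, Finset.mul_sum]
  refine Finset.sum_congr rfl fun l _ => ?_
  split_ifs <;> simp
end

section
/- For every 1 ≤ l ≤ D the CTW mixture weights satisfy the multiplicative recursion ω_{n,l} / ω_{n,l−1} = (1−λ) · λ^{−𝟙[l=D]} · (p^e_{n,s_{n,l}} / p^e_{n,s_{n,l−1}}) · (Π_{q∈𝒜} p^w_{n,q s_{n,l−1}}) / p^w_{n,s_{n,l}}, where 𝟙[l=D] equals 1 if l = D and 0 otherwise; equivalently, ln ω_{n,l} − ln ω_{n,l−1} = ln(1−λ) − 𝟙[l=D]·ln λ + ln p^e_{n,s_{n,l}} − ln p^e_{n,s_{n,l−1}} + Σ_{q∈𝒜} ln p^w_{n,q s_{n,l−1}} − ln p^w_{n,s_{n,l}}.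 -/
open scoped Classical

open Finset

section CTWRecursion

variable {𝒜 : Type*}

theorem append_singleton_suffix_append_singleton {s t : List 𝒜} {a b : 𝒜} :
    s ++ [a] <:+ t ++ [b] ↔ s <:+ t ∧ a = b := by
  constructor
  · rintro ⟨r, hr⟩
    rw [← List.append_assoc] at hr
    obtain ⟨h₁, h₂⟩ := List.append_inj' hr rfl
    exact ⟨⟨r, h₁⟩, by simpa using h₂⟩
  · rintro ⟨⟨r, rfl⟩, rfl⟩
    exact ⟨r, by simp⟩

theorem isContextTree_singleton_nil (D : ℕ) : IsContextTree D ({[]} : Finset (List 𝒜)) := by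
  refine ⟨by simp, by simp, fun w _ => ⟨[], by simp, ?_⟩⟩
  simp

theorem IsContextTree.eq_singleton_nil {D : ℕ} {T : Finset (List 𝒜)} (hT : IsContextTree D T)
    (h : [] ∈ T) : T = {[]} := by
  ext t
  simp only [mem_singleton]
  exact ⟨fun ht => (hT.2.1 [] h t ht List.nil_suffix).symm, fun ht => ht ▸ h⟩

theorem mem_contextTrees [Fintype 𝒜] {D : ℕ} {T : Finset (List 𝒜)} :
    T ∈ contextTrees 𝒜 D ↔ IsContextTree D T := by
  simp only [contextTrees, mem_filter, mem_powerset, and_iff_right_iff_imp]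
  intro hT s hs
  simpa [stringsLe] using hT.1 s hs

theorem contextTrees_zero [Fintype 𝒜] : contextTrees 𝒜 0 = {{[]}} := by
  ext T
  rw [mem_contextTrees, mem_singleton]
  refine ⟨fun hT => hT.eq_singleton_nil ?_, fun hT => hT ▸ isContextTree_singleton_nil 0⟩
  obtain ⟨s, ⟨hs, hsuffix⟩, -⟩ := hT.2.2 [] rfl
  rwa [List.suffix_nil.1 hsuffix] at hs

/-- Appending a fixed symbol at the root end of a string, as an embedding. -/
def appendSymbol (q : 𝒜) : List 𝒜 ↪ List 𝒜 :=
  ⟨fun s => s ++ [q], fun _ _ h => List.append_cancel_right h⟩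

@[simp]
theorem appendSymbol_apply (q : 𝒜) (s : List 𝒜) : appendSymbol q s = s ++ [q] := rfl

/-- The leaf set of the subtree hanging off the child `q` of the root. -/
noncomputable def childTree (T : Finset (List 𝒜)) (q : 𝒜) : Finset (List 𝒜) :=
  T.preimage (appendSymbol q) (appendSymbol q).injective.injOn

/-- The leaf set of the tree whose root has the children `g q`. -/
noncomputable def joinTrees [Fintype 𝒜] (g : 𝒜 → Finset (List 𝒜)) : Finset (List 𝒜) :=
  univ.biUnion fun q => (g q).map (appendSymbol q)

theorem mem_childTree {T : Finset (List 𝒜)} {q : 𝒜} {s : List 𝒜} :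
    s ∈ childTree T q ↔ s ++ [q] ∈ T := by
  simp [childTree]

theorem append_singleton_mem_joinTrees [Fintype 𝒜] {g : 𝒜 → Finset (List 𝒜)} {q : 𝒜}
    {s : List 𝒜} : s ++ [q] ∈ joinTrees g ↔ s ∈ g q := by
  simp only [joinTrees, mem_biUnion, mem_univ, true_and, mem_map, appendSymbol_apply]
  constructor
  · rintro ⟨r, t, ht, h⟩
    obtain ⟨rfl, h₂⟩ := List.append_inj' h rfl
    obtain rfl : r = q := by simpa using h₂
    exact ht
  · exact fun h => ⟨q, s, h, rfl⟩

theorem nil_notMem_joinTrees [Fintype 𝒜] (g : 𝒜 → Finset (List 𝒜)) : [] ∉ joinTrees g := by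
  simp [joinTrees]

theorem childTree_joinTrees [Fintype 𝒜] (g : 𝒜 → Finset (List 𝒜)) :
    childTree (joinTrees g) = g := by
  ext q s
  rw [mem_childTree, append_singleton_mem_joinTrees]

theorem joinTrees_childTree [Fintype 𝒜] {T : Finset (List 𝒜)} (h : [] ∉ T) :
    joinTrees (childTree T) = T := by
  ext t
  rcases List.eq_nil_or_concat' t with rfl | ⟨s, q, rfl⟩
  · simp [h, nil_notMem_joinTrees]
  · rw [append_singleton_mem_joinTrees, mem_childTree]

theorem isContextTree_joinTrees [Fintype 𝒜] {D : ℕ} {g : 𝒜 → Finset (List 𝒜)}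
    (hg : ∀ q, IsContextTree D (g q)) : IsContextTree (D + 1) (joinTrees g) := by
  refine ⟨fun s hs => ?_, fun s hs t ht hst => ?_, fun w hw => ?_⟩
  · rcases List.eq_nil_or_concat' s with rfl | ⟨s, q, rfl⟩
    · simp
    · simpa using (hg q).1 s (append_singleton_mem_joinTrees.1 hs)
  · rcases List.eq_nil_or_concat' s with rfl | ⟨s, q, rfl⟩
    · exact absurd hs (nil_notMem_joinTrees g)
    rcases List.eq_nil_or_concat' t with rfl | ⟨t, r, rfl⟩
    · exact absurd ht (nil_notMem_joinTrees g)
    obtain ⟨h, rfl⟩ := append_singleton_suffix_append_singleton.1 hst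
    rw [(hg q).2.1 s (append_singleton_mem_joinTrees.1 hs) t
      (append_singleton_mem_joinTrees.1 ht) h]
  · rcases List.eq_nil_or_concat' w with rfl | ⟨w, q, rfl⟩
    · simp at hw
    obtain ⟨s, ⟨hs, hsw⟩, huniq⟩ := (hg q).2.2 w (by simpa using hw)
    refine ⟨s ++ [q], ⟨append_singleton_mem_joinTrees.2 hs,
      append_singleton_suffix_append_singleton.2 ⟨hsw, rfl⟩⟩, ?_⟩
    rintro t ⟨ht, htw⟩
    rcases List.eq_nil_or_concat' t with rfl | ⟨t, r, rfl⟩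
    · exact absurd ht (nil_notMem_joinTrees g)
    obtain ⟨h, rfl⟩ := append_singleton_suffix_append_singleton.1 htw
    rw [huniq t ⟨append_singleton_mem_joinTrees.1 ht, h⟩]

theorem IsContextTree.childTree {D : ℕ} {T : Finset (List 𝒜)} (hT : IsContextTree (D + 1) T)
    (hnil : [] ∉ T) (q : 𝒜) : IsContextTree D (childTree T q) := by
  refine ⟨fun s hs => ?_, fun s hs t ht hst => ?_, fun w hw => ?_⟩
  · simpa using hT.1 _ (mem_childTree.1 hs)
  · exact List.append_cancel_right (hT.2.1 _ (mem_childTree.1 hs) _ (mem_childTree.1 ht)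
      (append_singleton_suffix_append_singleton.2 ⟨hst, rfl⟩))
  · obtain ⟨s, ⟨hs, hsw⟩, huniq⟩ := hT.2.2 (w ++ [q]) (by simpa using hw)
    rcases List.eq_nil_or_concat' s with rfl | ⟨s, r, rfl⟩
    · exact absurd hs hnil
    obtain ⟨h, rfl⟩ := append_singleton_suffix_append_singleton.1 hsw
    refine ⟨s, ⟨mem_childTree.2 hs, h⟩, ?_⟩
    rintro t ⟨ht, htw⟩
    exact List.append_cancel_right (huniq (t ++ [r]) ⟨mem_childTree.1 ht,
      append_singleton_suffix_append_singleton.2 ⟨htw, rfl⟩⟩)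

theorem prod_joinTrees [Fintype 𝒜] {M : Type*} [CommMonoid M] (g : 𝒜 → Finset (List 𝒜))
    (f : List 𝒜 → M) : ∏ s ∈ joinTrees g, f s = ∏ q, ∏ s ∈ g q, f (s ++ [q]) := by
  rw [joinTrees, prod_biUnion]
  · simp
  · intro q _ r _ hqr
    simp only [Function.onFun, disjoint_left, mem_map, appendSymbol_apply]
    rintro _ ⟨s, -, rfl⟩ ⟨t, -, h⟩
    have h₂ := (List.append_inj' h rfl).2
    exact hqr (by simpa using h₂.symm)

theorem sum_joinTrees [Fintype 𝒜] (g : 𝒜 → Finset (List 𝒜)) (f : List 𝒜 → ℕ) :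
    ∑ s ∈ joinTrees g, f s = ∑ q, ∑ s ∈ g q, f (s ++ [q]) :=
  prod_joinTrees (M := Multiplicative ℕ) g f

theorem card_joinTrees [Fintype 𝒜] (g : 𝒜 → Finset (List 𝒜)) :
    (joinTrees g).card = ∑ q, (g q).card := by
  simpa using sum_joinTrees g fun _ => 1

theorem card_joinTrees_of_card_eq [Fintype 𝒜] (hA : 2 ≤ Fintype.card 𝒜)
    {g : 𝒜 → Finset (List 𝒜)} {m : 𝒜 → ℕ}
    (hm : ∀ q, (g q).card = 1 + (Fintype.card 𝒜 - 1) * m q) :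
    (joinTrees g).card = 1 + (Fintype.card 𝒜 - 1) * (1 + ∑ q, m q) := by
  rw [card_joinTrees, sum_congr rfl fun q _ => hm q, sum_add_distrib, ← mul_sum, mul_add]
  simp only [sum_const, card_univ, smul_eq_mul, mul_one]
  omega

theorem IsContextTree.exists_card_eq [Fintype 𝒜] (hA : 2 ≤ Fintype.card 𝒜) {D : ℕ}
    {T : Finset (List 𝒜)} (hT : IsContextTree D T) :
    ∃ m, T.card = 1 + (Fintype.card 𝒜 - 1) * m := by
  induction D generalizing T with
  | zero =>
    rw [← mem_contextTrees, contextTrees_zero, mem_singleton] at hT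
    exact ⟨0, by simp [hT]⟩
  | succ D ih =>
    by_cases hnil : [] ∈ T
    · exact ⟨0, by simp [hT.eq_singleton_nil hnil]⟩
    choose m hm using fun q => ih (hT.childTree hnil q)
    refine ⟨1 + ∑ q, m q, ?_⟩
    rw [← joinTrees_childTree hnil, card_joinTrees_of_card_eq hA hm]

theorem priorD_eq [Fintype 𝒜] (lam : ℝ) (D : ℕ) (T : Finset (List 𝒜)) :
    priorD lam D T = (1 - lam) ^ ((T.card - 1) / (Fintype.card 𝒜 - 1)) *
      ∏ s ∈ T, if s.length = D then 1 else lam := by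
  have h := card_filter_add_card_filter_not (s := T) (fun s => s.length = D)
  rw [priorD, prod_ite]
  simp only [prod_const_one, prod_const, one_mul]
  congr 2
  omega

theorem priorD_joinTrees [Fintype 𝒜] (hA : 2 ≤ Fintype.card 𝒜) (lam : ℝ) {D : ℕ}
    {g : 𝒜 → Finset (List 𝒜)} (hg : ∀ q, IsContextTree D (g q)) :
    priorD lam (D + 1) (joinTrees g) = (1 - lam) * ∏ q, priorD lam D (g q) := by
  choose m hm using fun q => (hg q).exists_card_eq hA
  have hpos : 0 < Fintype.card 𝒜 - 1 := by omega
  simp only [priorD_eq, card_joinTrees_of_card_eq hA hm, hm, prod_mul_distrib, prod_joinTrees,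
    List.length_append,
    List.length_singleton, Nat.add_right_cancel_iff, Nat.add_sub_cancel_left,
    Nat.mul_div_cancel_left _ hpos, prod_pow_eq_pow_sum, pow_add, pow_one, mul_assoc]

theorem priorD_singleton_nil [Fintype 𝒜] (lam : ℝ) (D : ℕ) :
    priorD lam D ({[]} : Finset (List 𝒜)) = if D = 0 then 1 else lam := by
  simp [priorD_eq, eq_comm]

/-- The weighted probability at the root of a tree of depth `k`, for arbitrary leaf values. -/
noncomputable def rootWeight [Fintype 𝒜] (lam : ℝ) : ℕ → (List 𝒜 → ℝ) → ℝ
  | 0, f => f []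
  | k + 1, f => lam * f [] + (1 - lam) * ∏ q, rootWeight lam k fun t => f (t ++ [q])

theorem sum_contextTrees [Fintype 𝒜] (hA : 2 ≤ Fintype.card 𝒜) (lam : ℝ) (D : ℕ)
    (f : List 𝒜 → ℝ) :
    ∑ T ∈ contextTrees 𝒜 D, priorD lam D T * ∏ s ∈ T, f s = rootWeight lam D f := by
  induction D generalizing f with
  | zero => simp [contextTrees_zero, priorD_singleton_nil, rootWeight]
  | succ D ih =>
    have hmem : ({[]} : Finset (List 𝒜)) ∈ contextTrees 𝒜 (D + 1) :=
      mem_contextTrees.2 (isContextTree_singleton_nil _)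
    have hnil : ∀ {T : Finset (List 𝒜)}, T ∈ (contextTrees 𝒜 (D + 1)).erase {[]} → [] ∉ T :=
      fun hT h => (mem_erase.1 hT).1 ((mem_contextTrees.1 (mem_erase.1 hT).2).eq_singleton_nil h)
    rw [← add_sum_erase _ _ hmem, rootWeight, priorD_singleton_nil, if_neg D.succ_ne_zero,
      prod_singleton]
    congr 1
    simp_rw [← ih, prod_univ_sum, mul_sum]
    refine sum_nbij' childTree joinTrees (fun T hT => ?_) (fun g hg => ?_)
      (fun T hT => joinTrees_childTree (hnil hT)) (fun g _ => childTree_joinTrees g)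
      (fun T hT => ?_)
    · exact Fintype.mem_piFinset.2 fun q => mem_contextTrees.2
        ((mem_contextTrees.1 (mem_erase.1 hT).2).childTree (hnil hT) q)
    · refine mem_erase.2 ⟨fun h => nil_notMem_joinTrees g (h ▸ mem_singleton_self _), ?_⟩
      exact mem_contextTrees.2 (isContextTree_joinTrees fun q =>
        mem_contextTrees.1 (Fintype.mem_piFinset.1 hg q))
    · conv_lhs => rw [← joinTrees_childTree (hnil hT)]
      rw [priorD_joinTrees hA lam fun q =>
        (mem_contextTrees.1 (mem_erase.1 hT).2).childTree (hnil hT) q, prod_joinTrees,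
        prod_mul_distrib, mul_assoc]

/-- The part of `rootWeight lam k f` carried by the trees that have `u` as a leaf. -/
noncomputable def leafWeight [Fintype 𝒜] (lam : ℝ) (k : ℕ) (f : List 𝒜 → ℝ) (u : List 𝒜) : ℝ :=
  rootWeight lam k f - rootWeight lam k (Function.update f u 0)

theorem sum_contextTrees_mem [Fintype 𝒜] (hA : 2 ≤ Fintype.card 𝒜) (lam : ℝ) (D : ℕ)
    (f : List 𝒜 → ℝ) (u : List 𝒜) :
    (∑ T ∈ contextTrees 𝒜 D, if u ∈ T then priorD lam D T * ∏ s ∈ T, f s else 0) =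
      leafWeight lam D f u := by
  rw [leafWeight, ← sum_contextTrees hA, ← sum_contextTrees hA, ← sum_sub_distrib]
  refine sum_congr rfl fun T _ => ?_
  split_ifs with hu
  · rw [prod_eq_zero hu (Function.update_self u 0 f), mul_zero, sub_zero]
  · have h : ∀ s ∈ T, Function.update f u 0 s = f s := fun s hs =>
      Function.update_of_ne (ne_of_mem_of_not_mem hs hu) 0 f
    rw [prod_congr rfl h, sub_self]

theorem leafWeight_nil [Fintype 𝒜] (lam : ℝ) (k : ℕ) (f : List 𝒜 → ℝ) :
    leafWeight lam k f [] = (if k = 0 then 1 else lam) * f [] := by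
  cases k <;> simp [leafWeight, rootWeight]

theorem leafWeight_append_singleton [Fintype 𝒜] (lam : ℝ) (k : ℕ) (f : List 𝒜 → ℝ)
    (u : List 𝒜) (a : 𝒜) :
    leafWeight lam (k + 1) f (u ++ [a]) =
      (1 - lam) * leafWeight lam k (fun t => f (t ++ [a])) u *
        ∏ q ∈ univ.erase a, rootWeight lam k fun t => f (t ++ [q]) := by
  have hself : (fun t => Function.update f (u ++ [a]) 0 (t ++ [a])) =
      Function.update (fun t => f (t ++ [a])) u 0 := by
    funext t
    simp [Function.update_apply]
  have hne : ∀ q ∈ univ.erase a, (rootWeight lam k fun t =>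
      Function.update f (u ++ [a]) 0 (t ++ [q])) = rootWeight lam k fun t => f (t ++ [q]) := by
    intro q hq
    congr 1
    funext t
    refine Function.update_of_ne (fun h => (mem_erase.1 hq).1 ?_) 0 f
    simpa using (List.append_inj' h rfl).2
  rw [leafWeight, rootWeight, rootWeight, ← mul_prod_erase univ _ (mem_univ a),
    ← mul_prod_erase univ _ (mem_univ a), prod_congr rfl hne, hself,
    Function.update_of_ne (by simp), leafWeight]
  ring

theorem rootWeight_pos [Fintype 𝒜] {lam : ℝ} (hlam : lam ∈ Set.Ioo (0 : ℝ) 1) (k : ℕ)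
    {f : List 𝒜 → ℝ} (hf : ∀ s, 0 < f s) : 0 < rootWeight lam k f := by
  induction k generalizing f with
  | zero => exact hf []
  | succ k ih =>
    exact add_pos (mul_pos hlam.1 (hf [])) (mul_pos (sub_pos.2 hlam.2)
      (prod_pos fun q _ => ih fun t => hf (t ++ [q])))

theorem leafWeight_pos [Fintype 𝒜] {lam : ℝ} (hlam : lam ∈ Set.Ioo (0 : ℝ) 1) {k : ℕ}
    {f : List 𝒜 → ℝ} (hf : ∀ s, 0 < f s) {u : List 𝒜} (hu : u.length ≤ k) :
    0 < leafWeight lam k f u := by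
  induction k generalizing f u with
  | zero =>
    rw [List.length_eq_zero_iff.1 (Nat.le_zero.1 hu), leafWeight_nil]
    simpa using hf []
  | succ k ih =>
    rcases List.eq_nil_or_concat' u with rfl | ⟨u, q, rfl⟩
    · rw [leafWeight_nil, if_neg k.succ_ne_zero]
      exact mul_pos hlam.1 (hf [])
    · rw [leafWeight_append_singleton]
      exact mul_pos (mul_pos (sub_pos.2 hlam.2) (ih (fun t => hf _) (by simpa using hu)))
        (prod_pos fun q _ => rootWeight_pos hlam k fun t => hf _)

theorem leafWeight_cons [Fintype 𝒜] (lam : ℝ) {k : ℕ} (f : List 𝒜 → ℝ) (a : 𝒜) (u : List 𝒜) :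
    leafWeight lam (k + 1 + u.length) f (a :: u) *
        (lam * f u * rootWeight lam k fun t => f (t ++ a :: u)) =
      leafWeight lam (k + 1 + u.length) f u *
        ((1 - lam) * (if k = 0 then 1 else lam) * f (a :: u) *
          ∏ q, rootWeight lam k fun t => f (t ++ q :: u)) := by
  induction u using List.reverseRecOn generalizing f with
  | nil =>
    have h := leafWeight_append_singleton lam k f [] a
    simp only [List.nil_append] at h
    rw [List.length_nil, Nat.add_zero, h, leafWeight_nil, leafWeight_nil,
      if_neg k.succ_ne_zero, ← mul_prod_erase univ _ (mem_univ a), List.nil_append]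
    ring
  | append_singleton u b ih =>
    have h := ih fun t => f (t ++ [b])
    have hcons := leafWeight_append_singleton lam (k + 1 + u.length) f (a :: u) b
    simp only [List.append_assoc, List.cons_append] at h hcons
    rw [List.length_append, List.length_singleton, ← Nat.add_assoc, hcons,
      leafWeight_append_singleton]
    linear_combination (1 - lam) * (∏ q ∈ univ.erase b,
      rootWeight lam (k + 1 + u.length) fun t => f (t ++ [q])) * h

theorem pWaux_eq_rootWeight [Fintype 𝒜] [DecidableEq 𝒜] (α : 𝒜 → ℝ) (lam : ℝ) (x : ℤ → 𝒜)
    (D n k : ℕ) (s : List 𝒜) :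
    pWaux α lam x D n k s = rootWeight lam k fun t => pE α x D n (t ++ s) := by
  induction k generalizing s with
  | zero => rfl
  | succ k ih => simp [pWaux, rootWeight, ih]

theorem pE_pos [Fintype 𝒜] [DecidableEq 𝒜] [Nonempty 𝒜] {α : 𝒜 → ℝ} (hα : ∀ a, 0 < α a)
    (x : ℤ → 𝒜) (D n : ℕ) (s : List 𝒜) : 0 < pE α x D n s := by
  have h : ∀ a, 0 < (cnt x D n s a : ℝ) + α a := fun a =>
    add_pos_of_nonneg_of_pos (Nat.cast_nonneg _) (hα a)
  refine mul_pos (div_pos ?_ ?_) (prod_pos fun a _ => div_pos ?_ ?_)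
  · exact Real.Gamma_pos_of_pos (sum_pos (fun a _ => hα a) univ_nonempty)
  · exact Real.Gamma_pos_of_pos (sum_pos (fun a _ => h a) univ_nonempty)
  · exact Real.Gamma_pos_of_pos (h a)
  · exact Real.Gamma_pos_of_pos (hα a)

theorem pW_pos [Fintype 𝒜] [DecidableEq 𝒜] [Nonempty 𝒜] {α : 𝒜 → ℝ} (hα : ∀ a, 0 < α a)
    {lam : ℝ} (hlam : lam ∈ Set.Ioo (0 : ℝ) 1) (x : ℤ → 𝒜) (D n : ℕ) (s : List 𝒜) :
    0 < pW α lam x D n s := by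
  rw [pW, pWaux_eq_rootWeight]
  exact rootWeight_pos hlam _ fun t => pE_pos hα x D n _

theorem omegaW_eq_leafWeight_div [Fintype 𝒜] [DecidableEq 𝒜] (hA : 2 ≤ Fintype.card 𝒜)
    (α : 𝒜 → ℝ) (lam : ℝ) (x : ℤ → 𝒜) (D n l : ℕ) :
    omegaW α lam x D n l =
      leafWeight lam D (pE α x D n) (sfx x n l) / pW α lam x D n [] := by
  rw [omegaW, ← sum_contextTrees_mem hA, sum_filter]
  congr 1
  exact sum_congr rfl fun T _ => by congr

theorem sfx_eq_map (x : ℤ → 𝒜) (n : ℤ) (l : ℕ) :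
    sfx x n l = (List.range l).map fun i : ℕ => x (n - l + 1 + i) := by
  simp [sfx, ← List.map_eq_flatMap]

theorem length_sfx (x : ℤ → 𝒜) (n : ℤ) (l : ℕ) : (sfx x n l).length = l := by
  simp [sfx]

theorem sfx_succ (x : ℤ → 𝒜) (n : ℤ) (l : ℕ) : sfx x n (l + 1) = x (n - l) :: sfx x n l := by
  rw [sfx_eq_map, sfx_eq_map, List.range_succ_eq_map, List.map_cons, List.map_map,
    List.cons.injEq]
  refine ⟨congrArg x (by push_cast; ring), List.map_congr_left fun i _ => congrArg x ?_⟩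
  push_cast
  ring

theorem omegaW_pos [Fintype 𝒜] [DecidableEq 𝒜] (hA : 2 ≤ Fintype.card 𝒜) {α : 𝒜 → ℝ}
    (hα : ∀ a, 0 < α a) {lam : ℝ} (hlam : lam ∈ Set.Ioo (0 : ℝ) 1) (x : ℤ → 𝒜) {D l : ℕ}
    (n : ℕ) (hl : l ≤ D) : 0 < omegaW α lam x D n l := by
  have : Nonempty 𝒜 := Fintype.card_pos_iff.1 (by omega)
  rw [omegaW_eq_leafWeight_div hA]
  exact div_pos (leafWeight_pos hlam (pE_pos hα x D n) (by rwa [length_sfx]))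
    (pW_pos hα hlam x D n [])

theorem omegaW_succ_mul [Fintype 𝒜] [DecidableEq 𝒜] (hA : 2 ≤ Fintype.card 𝒜) (α : 𝒜 → ℝ)
    (lam : ℝ) (x : ℤ → 𝒜) {D m : ℕ} (n : ℕ) (hm : m < D) :
    omegaW α lam x D n (m + 1) *
        (lam * pE α x D n (sfx x n m) * pW α lam x D n (sfx x n (m + 1))) =
      omegaW α lam x D n m *
        ((1 - lam) * (if m + 1 = D then 1 else lam) * pE α x D n (sfx x n (m + 1)) *
          ∏ q, pW α lam x D n (q :: sfx x n m)) := by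
  obtain ⟨k, rfl⟩ : ∃ k, D = k + 1 + m := ⟨D - 1 - m, by omega⟩
  have h := leafWeight_cons lam (k := k) (pE α x (k + 1 + m) n) (x (n - m)) (sfx x n m)
  rw [length_sfx] at h
  have hk : k + 1 + m - (m + 1) = k := by omega
  have hif : m + 1 = k + 1 + m ↔ k = 0 := by omega
  simp only [omegaW_eq_leafWeight_div hA, sfx_succ, pW, List.length_cons, length_sfx, hk,
    pWaux_eq_rootWeight _ _ _ _ _ k, hif]
  rw [div_mul_eq_mul_div, div_mul_eq_mul_div, h]

end CTWRecursion

/-- Multiplicative recursion for the CTW mixture weights, together with its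
equivalent logarithmic form. -/
theorem omega_ratio_recursion {𝒜 : Type*} [Fintype 𝒜] [DecidableEq 𝒜]
    (hA : 2 ≤ Fintype.card 𝒜) (D n : ℕ) (hD : 1 ≤ D) (hn : 1 ≤ n)
    (lam : ℝ) (hlam : lam ∈ Set.Ioo (0 : ℝ) 1)
    (α : 𝒜 → ℝ) (hα : ∀ a, 0 < α a) (x : ℤ → 𝒜)
    (l : ℕ) (hl : 1 ≤ l) (hlD : l ≤ D) :
    (omegaW α lam x D n l / omegaW α lam x D n (l - 1) =
      (1 - lam) * (if l = D then lam⁻¹ else 1) *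
        (pE α x D n (sfx x (n : ℤ) l) / pE α x D n (sfx x (n : ℤ) (l - 1))) *
        (∏ q, pW α lam x D n (q :: sfx x (n : ℤ) (l - 1))) / pW α lam x D n (sfx x (n : ℤ) l))
    ∧
    (Real.log (omegaW α lam x D n l) - Real.log (omegaW α lam x D n (l - 1)) =
      Real.log (1 - lam) - (if l = D then Real.log lam else 0)
        + Real.log (pE α x D n (sfx x (n : ℤ) l)) - Real.log (pE α x D n (sfx x (n : ℤ) (l - 1)))
        + (∑ q, Real.log (pW α lam x D n (q :: sfx x (n : ℤ) (l - 1))))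
        - Real.log (pW α lam x D n (sfx x (n : ℤ) l))) := by
  obtain ⟨m, rfl⟩ : ∃ m, l = m + 1 := ⟨l - 1, by omega⟩
  have : Nonempty 𝒜 := Fintype.card_pos_iff.1 (by omega)
  simp only [Nat.add_sub_cancel]
  have hlam0 := hlam.1.ne'
  have hlam1 : 1 - lam ≠ 0 := (sub_pos.2 hlam.2).ne'
  have hω := (omegaW_pos hA hα hlam x n hlD).ne'
  have hω' := (omegaW_pos hA hα hlam x n (by omega : m ≤ D)).ne'
  have hE := fun s => (pE_pos hα x D n s).ne'
  have hW := fun s => (pW_pos hα hlam x D n s).ne'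
  have hratio : omegaW α lam x D n (m + 1) / omegaW α lam x D n m =
      (1 - lam) * (if m + 1 = D then lam⁻¹ else 1) *
        (pE α x D n (sfx x (n : ℤ) (m + 1)) / pE α x D n (sfx x (n : ℤ) m)) *
        (∏ q, pW α lam x D n (q :: sfx x (n : ℤ) m)) /
          pW α lam x D n (sfx x (n : ℤ) (m + 1)) := by
    have h := omegaW_succ_mul hA α lam x n hlD
    have hE' := hE (sfx x n m)
    have hW' := hW (sfx x n (m + 1))
    rw [div_eq_iff hω']
    refine mul_right_cancel₀ (mul_ne_zero (mul_ne_zero hlam0 hE') hW') (h.trans ?_)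
    split_ifs <;> field_simp
  refine ⟨hratio, ?_⟩
  have hprod : ∏ q, pW α lam x D n (q :: sfx x (n : ℤ) m) ≠ 0 :=
    Finset.prod_ne_zero_iff.2 fun q _ => hW _
  have hif : (if m + 1 = D then lam⁻¹ else 1) ≠ 0 := by
    split_ifs
    exacts [inv_ne_zero hlam0, one_ne_zero]
  have hlogif : Real.log (if m + 1 = D then lam⁻¹ else 1) =
      -(if m + 1 = D then Real.log lam else 0) := by
    split_ifs <;> simp
  have hdiv := div_ne_zero (hE (sfx x n (m + 1))) (hE (sfx x n m))
  rw [← Real.log_div hω hω', hratio,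
    Real.log_div (mul_ne_zero (mul_ne_zero (mul_ne_zero hlam1 hif) hdiv) hprod) (hW _),
    Real.log_mul (mul_ne_zero (mul_ne_zero hlam1 hif) hdiv) hprod,
    Real.log_mul (mul_ne_zero hlam1 hif) hdiv, Real.log_mul hlam1 hif, hlogif,
    Real.log_div (hE _) (hE _), Real.log_prod fun q _ => hW _]
  ring
end
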